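/- Emptying time bound: let q be a solution of the logistic queue model on [t0, ∞) with q(t0) ≥ 0, let tX ≥ t0 and 0 ≤ X∞ < μ be such that X(t) ≤ X∞ for all t ≥ tX, write β = μ - X∞ and qX = q(tX), assume qX > 0, and let ε ∈ (0, qX). Then for every t ≥ tX + (qX - ε)/β + log(qX/ε)/(α·β) such that q(s) > 0 for all s ∈ [tX, t], one has q(t) ≤ ε. -/

import Mathlib

/-- The elementary bound `x / (1 + x) ≤ 1 - exp (-x)`, cleared of denominators. -/
lemma le_one_sub_exp_neg_mul_one_add (x : ℝ) :
    x ≤ (1 - Real.exp (-x)) * (1 + x) := by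
  have h1 : Real.exp (-x) * (1 + x) ≤ Real.exp (-x) * Real.exp x :=
    mul_le_mul_of_nonneg_left (by linarith [Real.add_one_le_exp x]) (Real.exp_pos _).le
  rw [← Real.exp_add, neg_add_cancel, Real.exp_zero] at h1
  linarith

/-- While the inflow is at most `Xinf ≤ μ` and the queue is positive, the outflow term makes
`q + log q / α` decrease at rate at least `μ - Xinf`. -/
lemma logistic_rate_le {μ α Xinf x y : ℝ} (hα : 0 < α) (hXinf : Xinf ≤ μ) (hx : x ≤ Xinf)
    (hy : 0 < y) :
    (x - (μ + Real.exp (-α * y) * (min μ x - μ))) * (1 + (α * y)⁻¹) ≤ -(μ - Xinf) := by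
  have hαy : 0 < α * y := mul_pos hα hy
  have key := le_one_sub_exp_neg_mul_one_add (α * y)
  rw [min_eq_right (hx.trans hXinf), neg_mul]
  have h1 : 1 ≤ (1 - Real.exp (-(α * y))) * (1 + (α * y)⁻¹) := by
    have h2 : (1 - Real.exp (-(α * y))) * (1 + (α * y)⁻¹)
        = (1 - Real.exp (-(α * y))) * (1 + α * y) / (α * y) := by
      field_simp
      ring
    rwa [h2, one_le_div hαy]
  nlinarith [mul_le_mul_of_nonneg_left h1 (sub_nonneg.2 (hx.trans hXinf))]

/-- Emptying time bound: with `β = μ - Xinf` and `qX = q tX > 0`, for every `ε ∈ (0, qX)`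
and every `t ≥ tX + (qX - ε)/β + log (qX/ε)/(α*β)` such that the queue stays positive
on `[tX, t]`, one has `q t ≤ ε`. -/
theorem logistic_queue_emptying_time
    (t0 μ α : ℝ) (hμ : 0 < μ) (hα : 0 < α)
    (X : ℝ → ℝ) (hXcont : ContinuousOn X (Set.Ici t0))
    (hXpos : ∀ t ∈ Set.Ici t0, 0 ≤ X t)
    (q : ℝ → ℝ)
    (hq : ∀ t ∈ Set.Ici t0,
      HasDerivWithinAt q
        (X t - (μ + Real.exp (-α * q t) * (min μ (X t) - μ)))
        (Set.Ici t0) t)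
    (hq0 : 0 ≤ q t0)
    (tX Xinf : ℝ) (htX : t0 ≤ tX) (hXinf0 : 0 ≤ Xinf) (hXinfμ : Xinf < μ)
    (hXbound : ∀ t, tX ≤ t → X t ≤ Xinf)
    (hqX : 0 < q tX)
    (ε : ℝ) (hε0 : 0 < ε) (hεqX : ε < q tX) :
    ∀ t, tX + (q tX - ε) / (μ - Xinf) + Real.log (q tX / ε) / (α * (μ - Xinf)) ≤ t →
      (∀ s ∈ Set.Icc tX t, 0 < q s) → q t ≤ ε := by
  intro t ht hpos
  by_contra! hlt
  have hβ : 0 < μ - Xinf := sub_pos.2 hXinfμ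
  have hlog : 0 < Real.log (q tX / ε) := Real.log_pos ((one_lt_div hε0).2 hεqX)
  have htXt : tX ≤ t := by
    have h1 : 0 < (q tX - ε) / (μ - Xinf) := div_pos (sub_pos.2 hεqX) hβ
    have h2 : 0 < Real.log (q tX / ε) / (α * (μ - Xinf)) := div_pos hlog (mul_pos hα hβ)
    linarith
  have hderiv : ∀ s ∈ Set.Icc tX t, HasDerivWithinAt
      (fun s => q s + Real.log (q s) / α + (μ - Xinf) * s)
      ((X s - (μ + Real.exp (-α * q s) * (min μ (X s) - μ))) +
        (X s - (μ + Real.exp (-α * q s) * (min μ (X s) - μ))) / q s / α + (μ - Xinf) * 1)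
      (Set.Icc tX t) s := by
    intro s hs
    have hqs := (hq s (htX.trans hs.1)).mono (fun u (hu : u ∈ Set.Icc tX t) => htX.trans hu.1)
    exact (hqs.add ((hqs.log (hpos s hs).ne').div_const α)).add
      ((hasDerivWithinAt_id s _).const_mul _)
  have hanti : AntitoneOn (fun s => q s + Real.log (q s) / α + (μ - Xinf) * s)
      (Set.Icc tX t) := by
    refine antitoneOn_of_hasDerivWithinAt_nonpos (convex_Icc tX t)
      (fun s hs => (hderiv s hs).continuousWithinAt)
      (fun s hs => (hderiv s (interior_subset hs)).mono interior_subset) (fun s hs => ?_)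
    have hs' := interior_subset hs
    have hrate := logistic_rate_le hα hXinfμ.le (hXbound s hs'.1) (hpos s hs')
    have hsplit (d : ℝ) : d + d / q s / α = d * (1 + (α * q s)⁻¹) := by
      rw [div_div, mul_comm (q s) α, mul_add, mul_one, div_eq_mul_inv]
    rw [hsplit]
    linarith
  have hF := hanti (Set.left_mem_Icc.2 htXt) (Set.right_mem_Icc.2 htXt) htXt
  simp only at hF
  have hlogt : Real.log ε / α < Real.log (q t) / α :=
    div_lt_div_of_pos_right (Real.log_lt_log hε0 hlt) hα
  have htime : (μ - Xinf) * tX + (q tX - ε) + (Real.log (q tX) / α - Real.log ε / α)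
      ≤ (μ - Xinf) * t := by
    refine le_of_eq_of_le ?_ (mul_le_mul_of_nonneg_left ht hβ.le)
    rw [Real.log_div hqX.ne' hε0.ne']
    field_simp
  linarith
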